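/- Let D be an integral domain that is not a field and let Q be its quotient field. Then fPD(D(+)Q) = fPD(D). -/

import Mathlib

open CategoryTheory

universe u

/-- `M` has a projective resolution `0 → P_n → ⋯ → P_0 → M → 0` of length at most `n`
(the `P_i` projective, not necessarily finitely generated). -/
def HasProjResLE (R : Type u) [CommRing R] :
    ℕ → ∀ (M : Type u) [AddCommGroup M] [Module R M], Prop
  | 0, M, _, _ => Module.Projective R M
  | n + 1, M, _, _ => ∃ (P : Type u) (_ : AddCommGroup P) (_ : Module R P) (f : P →ₗ[R] M),
      Module.Projective R P ∧ Function.Surjective f ∧ HasProjResLE R n (LinearMap.ker f)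

/-- `M` has a finite projective resolution `0 → P_n → ⋯ → P_0 → M → 0` of length `n`
with each `P_i` finitely generated projective. -/
def HasFPRLen (R : Type u) [CommRing R] :
    ℕ → ∀ (M : Type u) [AddCommGroup M] [Module R M], Prop
  | 0, M, _, _ => Module.Finite R M ∧ Module.Projective R M
  | n + 1, M, _, _ => ∃ (P : Type u) (_ : AddCommGroup P) (_ : Module R P) (f : P →ₗ[R] M),
      Module.Finite R P ∧ Module.Projective R P ∧ Function.Surjective f ∧
        HasFPRLen R n (LinearMap.ker f)

/-- `M` has a finite projective resolution by finitely generated projectives. -/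
def HasFPR (R : Type u) [CommRing R] (M : Type u) [AddCommGroup M] [Module R M] : Prop :=
  ∃ n, HasFPRLen R n M

/-- The projective dimension of `M`, as an element of `ℕ∞` (with `⊤` meaning no finite
projective resolution exists). -/
noncomputable def projDim (R : Type u) [CommRing R] (M : Type u) [AddCommGroup M]
    [Module R M] : ℕ∞ :=
  sInf {n : ℕ∞ | ∃ m : ℕ, n = m ∧ HasProjResLE R m M}

/-- The small finitistic dimension `fPD R`: the supremum, in `ℕ∞`, of the projective
dimensions of `R`-modules having a finite projective resolution. -/
noncomputable def fPD (R : Type u) [CommRing R] : ℕ∞ :=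
  ⨆ (M : ModuleCat.{u} R) (_ : HasFPR R M), projDim R M

/-- For a module over a commutative ring, the canonical right module structure. -/
noncomputable local instance moduleOpOfModule (R : Type u) [CommRing R] (M : Type u)
    [AddCommGroup M] [Module R M] : Module Rᵐᵒᵖ M :=
  Module.compHom M ((RingHom.id R).fromOpposite mul_comm)

local instance isCentralScalarOfModule (R : Type u) [CommRing R] (M : Type u)
    [AddCommGroup M] [Module R M] : IsCentralScalar R M :=
  ⟨fun _ _ => rfl⟩

open TensorProduct

section ProjectiveResolutions

variable {R : Type u} [CommRing R]

theorem hasProjResLE_iff_hasProjectiveDimensionLE (n : ℕ) (M : Type u) [AddCommGroup M]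
    [Module R M] :
    HasProjResLE R n M ↔ HasProjectiveDimensionLE (ModuleCat.of R M) n := by
  induction n generalizing M with
  | zero =>
    rw [← projective_iff_hasProjectiveDimensionLE_zero, ← IsProjective.iff_projective]
    rfl
  | succ n ih =>
    constructor
    · rintro ⟨P, _, _, f, hP, hf, hK⟩
      exact ((LinearMap.shortExact_shortComplexKer hf).hasProjectiveDimensionLT_X₃_iff n
        ((IsProjective.iff_projective P).mp hP)).mpr ((ih _).mp hK)
    · intro h
      have hf : Function.Surjective (Finsupp.linearCombination R (id : M → M)) :=
        Finsupp.linearCombination_id_surjective R M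
      refine ⟨M →₀ R, inferInstance, inferInstance, Finsupp.linearCombination R id,
        inferInstance, hf, (ih _).mpr ?_⟩
      exact ((LinearMap.shortExact_shortComplexKer hf).hasProjectiveDimensionLT_X₃_iff n
        ((IsProjective.iff_projective (M →₀ R)).mp inferInstance)).mp h

theorem hasProjResLE_ker_iff (n : ℕ) {P M : Type u} [AddCommGroup P] [Module R P]
    [AddCommGroup M] [Module R M] [Module.Projective R P] {f : P →ₗ[R] M}
    (hf : Function.Surjective f) :
    HasProjResLE R n (LinearMap.ker f) ↔ HasProjResLE R (n + 1) M := by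
  rw [hasProjResLE_iff_hasProjectiveDimensionLE, hasProjResLE_iff_hasProjectiveDimensionLE]
  exact ((LinearMap.shortExact_shortComplexKer hf).hasProjectiveDimensionLT_X₃_iff n
    ((IsProjective.iff_projective P).mp inferInstance)).symm

theorem HasProjResLE.of_linearEquiv {n : ℕ} {M N : Type u} [AddCommGroup M] [Module R M]
    [AddCommGroup N] [Module R N] (e : M ≃ₗ[R] N) (h : HasProjResLE R n M) :
    HasProjResLE R n N := by
  rw [hasProjResLE_iff_hasProjectiveDimensionLE] at h ⊢
  exact hasProjectiveDimensionLT_of_iso e.toModuleIso _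

theorem HasProjResLE.of_projective (n : ℕ) {M : Type u} [AddCommGroup M] [Module R M]
    (h : Module.Projective R M) : HasProjResLE R n M := by
  rw [hasProjResLE_iff_hasProjectiveDimensionLE]
  have := (IsProjective.iff_projective M).mp h
  exact hasProjectiveDimensionLT_of_ge _ 1 _ (by lia)

theorem HasFPRLen.of_linearEquiv {n : ℕ} {M N : Type u} [AddCommGroup M] [Module R M]
    [AddCommGroup N] [Module R N] (e : M ≃ₗ[R] N) (h : HasFPRLen R n M) :
    HasFPRLen R n N := by
  cases n with
  | zero =>
    obtain ⟨_, _⟩ := h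
    exact ⟨Module.Finite.equiv e, Module.Projective.of_equiv' e⟩
  | succ n =>
    obtain ⟨P, _, _, f, hfin, hproj, hf, hK⟩ := h
    refine ⟨P, inferInstance, inferInstance, e.toLinearMap ∘ₗ f, hfin, hproj,
      e.surjective.comp hf, ?_⟩
    rwa [LinearEquiv.ker_comp]

end ProjectiveResolutions

section BaseChange

variable {A B : Type u} [CommRing A] [CommRing B] [Algebra A B]

/-- Base change commutes with the kernel of a surjection when it keeps the inclusion of the
kernel injective. -/
noncomputable def LinearMap.baseChangeKerEquiv {P M : Type u} [AddCommGroup P] [Module A P]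
    [AddCommGroup M] [Module A M] (f : P →ₗ[A] M) (hf : Function.Surjective f)
    (hinj : Function.Injective ((LinearMap.ker f).subtype.baseChange B)) :
    B ⊗[A] LinearMap.ker f ≃ₗ[B] LinearMap.ker (f.baseChange B) :=
  have hexact : Function.Exact ((LinearMap.ker f).subtype.baseChange B) (f.baseChange B) :=
    lTensor_exact B f.exact_subtype_ker_map hf
  LinearEquiv.ofInjective _ hinj ≪≫ₗ
    LinearEquiv.ofEq _ _ (LinearMap.exact_iff.mp hexact).symm

variable (A B) in
/-- Base change to `B` preserves the exactness of finite projective resolutions over `A`. -/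
def BaseChangePreservesFPR : Prop :=
  ∀ (n : ℕ) (P M : Type u) [AddCommGroup P] [Module A P] [AddCommGroup M] [Module A M]
    (f : P →ₗ[A] M), Module.Projective A P → Function.Surjective f →
    HasFPRLen A n (LinearMap.ker f) →
    Function.Injective ((LinearMap.ker f).subtype.baseChange B)

theorem BaseChangePreservesFPR.hasFPRLen (hB : BaseChangePreservesFPR A B) {n : ℕ} {M : Type u}
    [AddCommGroup M] [Module A M] (h : HasFPRLen A n M) : HasFPRLen B n (B ⊗[A] M) := by
  induction n generalizing M with
  | zero =>
    obtain ⟨_, _⟩ := h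
    exact ⟨inferInstance, inferInstance⟩
  | succ n ih =>
    obtain ⟨P, _, _, f, hfin, hproj, hf, hK⟩ := h
    exact ⟨B ⊗[A] P, inferInstance, inferInstance, f.baseChange B, inferInstance, inferInstance,
      LinearMap.lTensor_surjective B hf,
      (ih hK).of_linearEquiv (f.baseChangeKerEquiv hf (hB n P M f hproj hf hK))⟩

theorem BaseChangePreservesFPR.hasProjResLE (hB : BaseChangePreservesFPR A B)
    (hproj : ∀ (n : ℕ) (M : Type u) [AddCommGroup M] [Module A M], HasFPRLen A n M →
      Module.Projective B (B ⊗[A] M) → Module.Projective A M)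
    {n k : ℕ} {M : Type u} [AddCommGroup M] [Module A M] (h : HasFPRLen A n M)
    (hk : HasProjResLE B k (B ⊗[A] M)) : HasProjResLE A k M := by
  induction k generalizing n M with
  | zero => exact hproj n M h hk
  | succ k ih =>
    cases n with
    | zero => exact .of_projective _ h.2
    | succ n =>
      obtain ⟨P, _, _, f, _, hP, hf, hK⟩ := h
      have hfB : Function.Surjective (f.baseChange B) := LinearMap.lTensor_surjective B hf
      rw [← hasProjResLE_ker_iff k hfB] at hk
      exact ⟨P, inferInstance, inferInstance, f, hP, hf,
        ih hK (hk.of_linearEquiv (f.baseChangeKerEquiv hf (hB n P M f hP hf hK)).symm)⟩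

theorem BaseChangePreservesFPR.fPD_le (hB : BaseChangePreservesFPR A B)
    (hproj : ∀ (n : ℕ) (M : Type u) [AddCommGroup M] [Module A M], HasFPRLen A n M →
      Module.Projective B (B ⊗[A] M) → Module.Projective A M) :
    fPD A ≤ fPD B := by
  refine iSup₂_le fun M ⟨n, hn⟩ => ?_
  refine le_trans ?_ (le_iSup₂ (f := fun (N : ModuleCat.{u} B) (_ : HasFPR B N) => projDim B N)
    (ModuleCat.of B (B ⊗[A] M)) ⟨n, hB.hasFPRLen hn⟩)
  refine le_sInf ?_
  rintro _ ⟨k, rfl, hk⟩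
  exact sInf_le ⟨k, rfl, hB.hasProjResLE hproj hn hk⟩

/-- A retract of rings `A → B → A` with `B` flat over `A` does not lower the small finitistic
dimension. -/
theorem fPD_le_of_flat_of_retract [Algebra B A] [IsScalarTower A B A] [Module.Flat A B] :
    fPD A ≤ fPD B := by
  refine BaseChangePreservesFPR.fPD_le (B := B) ?_ ?_
  · intro n P M _ _ _ _ f _ _ _
    exact Module.Flat.lTensor_preserves_injective_linearMap (M := B) _
      (LinearMap.ker f).injective_subtype
  · intro n M _ _ _ _
    exact Module.Projective.of_equiv' (AlgebraTensorModule.cancelBaseChange A B A A M ≪≫ₗ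
      TensorProduct.lid A M)

end BaseChange

/-- A square-zero prime ideal of a ring `A` that is a torsion-free divisible module over `A ⧸ I`,
any two elements of which have a common divisor in the ideal. The model is the ideal `0 (+) Q` of
`D (+) Q`, for a domain `D` with fraction field `Q`. -/
structure Ideal.IsSquareZeroDivisible {A : Type u} [CommRing A] (I : Ideal A) : Prop where
  isPrime : I.IsPrime
  mul_eq_zero : ∀ {a b : A}, a ∈ I → b ∈ I → a * b = 0
  mem_of_mul_eq_zero : ∀ {r q : A}, q ∈ I → q ≠ 0 → r * q = 0 → r ∈ I
  exists_mul_eq : ∀ {r q : A}, r ∉ I → q ∈ I → ∃ q' ∈ I, r * q' = q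
  exists_common_divisor : ∀ {a b : A}, a ∈ I → b ∈ I → ∃ c ∈ I, ∃ r s, a = r * c ∧ b = s * c

namespace Ideal.IsSquareZeroDivisible

variable {A : Type u} [CommRing A] {I : Ideal A}

theorem exists_eq_smul (hI : I.IsSquareZeroDivisible) {M : Type u} [AddCommGroup M] [Module A M]
    {x : M} (hx : x ∈ I • (⊤ : Submodule A M)) : ∃ q ∈ I, ∃ m : M, x = q • m := by
  induction hx using Submodule.smul_induction_on' with
  | smul r hr m _ => exact ⟨r, hr, m, rfl⟩
  | add x _ y _ hx hy =>
    obtain ⟨a, ha, m, rfl⟩ := hx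
    obtain ⟨b, hb, n, rfl⟩ := hy
    obtain ⟨c, hc, r, s, rfl, rfl⟩ := hI.exists_common_divisor ha hb
    exact ⟨c, hc, r • m + s • n, by simp only [smul_add, smul_smul, mul_comm c]⟩

/-- Up to multiplication by elements outside `I`, an element of `M` annihilated by a nonzero
element of `I` lies in `I M`. -/
def _root_.Ideal.AnnihilatedMemSMul (I : Ideal A) (M : Type u) [AddCommGroup M] [Module A M] :
    Prop :=
  ∀ (m : M), ∀ q ∈ I, q ≠ 0 → q • m = 0 → ∃ s ∉ I, s • m ∈ I • (⊤ : Submodule A M)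

theorem annihilatedMemSMul_of_projective (hI : I.IsSquareZeroDivisible) (P : Type u)
    [AddCommGroup P] [Module A P] [Module.Projective A P] : I.AnnihilatedMemSMul P := by
  intro p q hq hq0 hqp
  obtain ⟨i, hi⟩ := Module.projective_def'.mp (inferInstance : Module.Projective A P)
  refine ⟨1, fun h => hI.isPrime.ne_top ((Ideal.eq_top_iff_one I).mpr h), ?_⟩
  have hp : p = Finsupp.linearCombination A id (i p) := (LinearMap.congr_fun hi p).symm
  rw [one_smul, hp, Finsupp.linearCombination_apply]
  refine Submodule.sum_mem _ fun x _ => Submodule.smul_mem_smul ?_ Submodule.mem_top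
  refine hI.mem_of_mul_eq_zero hq hq0 ?_
  have h := DFunLike.congr_fun (map_smul i q p) x
  rw [hqp, map_zero, Finsupp.smul_apply, Finsupp.zero_apply, smul_eq_mul] at h
  rw [mul_comm, ← h]

theorem annihilatedMemSMul_of_surjective (hI : I.IsSquareZeroDivisible) {P M : Type u}
    [AddCommGroup P] [Module A P] [AddCommGroup M] [Module A M] {f : P →ₗ[A] M}
    (hf : Function.Surjective f) (hP : I.AnnihilatedMemSMul P)
    (hK : I.AnnihilatedMemSMul (LinearMap.ker f)) : I.AnnihilatedMemSMul M := by
  intro m q hq hq0 hqm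
  obtain ⟨p, rfl⟩ := hf m
  have hqp : q • p ∈ LinearMap.ker f := by rw [LinearMap.mem_ker, map_smul, hqm]
  obtain ⟨s, hs, hsq⟩ := hK ⟨q • p, hqp⟩ q hq hq0 <| Subtype.ext <| by
    change q • q • p = 0
    rw [smul_smul, hI.mul_eq_zero hq hq, zero_smul]
  obtain ⟨e, he, k, hk⟩ := hI.exists_eq_smul hsq
  replace hk : s • q • p = e • (k : P) := congrArg Subtype.val hk
  obtain ⟨c, hc, a, b, rfl, rfl⟩ := hI.exists_common_divisor hq he
  have ha : a ∉ I := fun ha => hq0 (hI.mul_eq_zero ha hc)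
  obtain ⟨t, ht, hmem⟩ := hP ((s * a) • p - b • (k : P)) c hc (right_ne_zero_of_mul hq0) <| by
    rw [smul_sub, sub_eq_zero, smul_smul, smul_smul, mul_comm c b, ← hk, smul_smul]
    congr 1
    ring
  refine ⟨t * (s * a), ?_, ?_⟩
  · have := hI.isPrime
    simp [this.mul_mem_iff_mem_or_mem, ht, hs, ha]
  · have h := Submodule.mem_map_of_mem (f := f) hmem
    rw [Submodule.map_smul'', map_smul, map_sub, map_smul, map_smul, LinearMap.mem_ker.mp k.2,
      smul_zero, sub_zero, smul_smul] at h
    exact Submodule.smul_mono le_rfl le_top h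

theorem annihilatedMemSMul_of_hasFPRLen (hI : I.IsSquareZeroDivisible) {n : ℕ} {M : Type u}
    [AddCommGroup M] [Module A M] (h : HasFPRLen A n M) : I.AnnihilatedMemSMul M := by
  induction n generalizing M with
  | zero =>
    have := h.2
    exact hI.annihilatedMemSMul_of_projective M
  | succ n ih =>
    obtain ⟨P, _, _, f, _, _, hf, hK⟩ := h
    exact hI.annihilatedMemSMul_of_surjective hf (hI.annihilatedMemSMul_of_projective P) (ih hK)

theorem mem_smul_ker (hI : I.IsSquareZeroDivisible) {P M : Type u}
    [AddCommGroup P] [Module A P] [AddCommGroup M] [Module A M] {f : P →ₗ[A] M}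
    (hf : Function.Surjective f) (hM : I.AnnihilatedMemSMul M) {x : LinearMap.ker f}
    (hx : (x : P) ∈ I • (⊤ : Submodule A P)) : x ∈ I • (⊤ : Submodule A (LinearMap.ker f)) := by
  obtain ⟨e, he, p, hp⟩ := hI.exists_eq_smul hx
  rcases eq_or_ne e 0 with rfl | he0
  · have : x = 0 := Subtype.ext (by simpa using hp)
    simp [this]
  obtain ⟨s, hs, hmem⟩ := hM (f p) e he he0 (by rw [← map_smul, ← hp, LinearMap.mem_ker.mp x.2])
  obtain ⟨e', he', m, hm⟩ := hI.exists_eq_smul hmem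
  obtain ⟨p', rfl⟩ := hf m
  obtain ⟨q, hq, rfl⟩ := hI.exists_mul_eq hs he
  have hk : s • p - e' • p' ∈ LinearMap.ker f := by
    rw [LinearMap.mem_ker, map_sub, map_smul, map_smul, hm, sub_self]
  have hxq : x = q • (⟨_, hk⟩ : LinearMap.ker f) := Subtype.ext <| by
    change (x : P) = q • (s • p - e' • p')
    rw [hp, smul_sub, smul_smul, smul_smul, hI.mul_eq_zero hq he', zero_smul, sub_zero, mul_comm]
  rw [hxq]
  exact Submodule.smul_mem_smul hq Submodule.mem_top

end Ideal.IsSquareZeroDivisible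

section SurjectiveBaseChange

variable {A B : Type u} [CommRing A] [CommRing B] [Algebra A B]

theorem exists_one_tmul_eq (hsurj : Function.Surjective (algebraMap A B)) {M : Type u}
    [AddCommGroup M] [Module A M] (x : B ⊗[A] M) : ∃ m : M, (1 : B) ⊗ₜ[A] m = x :=
  TensorProduct.mk_surjective A M B hsurj x

theorem one_tmul_eq_zero_iff (hsurj : Function.Surjective (algebraMap A B)) {M : Type u}
    [AddCommGroup M] [Module A M] (m : M) :
    (1 : B) ⊗ₜ[A] m = 0 ↔ m ∈ RingHom.ker (algebraMap A B) • (⊤ : Submodule A M) := by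
  constructor
  · intro h
    have hexact : Function.Exact (RingHom.ker (algebraMap A B)).subtype (Algebra.linearMap A B) :=
      fun a => by simp [RingHom.mem_ker]
    obtain ⟨y, hy⟩ := (rTensor_exact M hexact hsurj ((1 : A) ⊗ₜ m)).mp (by simpa using h)
    have hy' := congrArg (TensorProduct.lid A M) hy
    rw [TensorProduct.lid_tmul, one_smul] at hy'
    rw [← hy']
    clear hy hy' h
    induction y with
    | zero => simp
    | tmul a n => simpa using Submodule.smul_mem_smul a.2 Submodule.mem_top
    | add x y hx hy => simpa using add_mem hx hy
  · intro h
    induction h using Submodule.smul_induction_on' with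
    | smul a ha n _ =>
      rw [← TensorProduct.smul_tmul, Algebra.smul_def, RingHom.mem_ker.mp ha, zero_mul,
        TensorProduct.zero_tmul]
    | add x _ y _ hx hy => rw [TensorProduct.tmul_add, hx, hy, add_zero]

theorem Ideal.IsSquareZeroDivisible.baseChangePreservesFPR
    (hsurj : Function.Surjective (algebraMap A B))
    (hI : (RingHom.ker (algebraMap A B)).IsSquareZeroDivisible) : BaseChangePreservesFPR A B := by
  intro n P M _ _ _ _ f hP hf hK
  rw [injective_iff_map_eq_zero]
  intro x hx
  obtain ⟨k, rfl⟩ := exists_one_tmul_eq hsurj x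
  rw [LinearMap.baseChange_tmul, one_tmul_eq_zero_iff hsurj] at hx
  rw [one_tmul_eq_zero_iff hsurj]
  exact hI.mem_smul_ker hf (hI.annihilatedMemSMul_of_surjective hf
    (hI.annihilatedMemSMul_of_projective P) (hI.annihilatedMemSMul_of_hasFPRLen hK)) hx

/-- A retraction of `ι` after base change along a surjection with square-zero kernel lifts. -/
theorem exists_retraction_of_baseChange (hsurj : Function.Surjective (algebraMap A B))
    (hsq : ∀ {a b : A}, a ∈ RingHom.ker (algebraMap A B) → b ∈ RingHom.ker (algebraMap A B) →
      a * b = 0)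
    {K P : Type u} [AddCommGroup K] [Module A K] [AddCommGroup P] [Module A P]
    [Module.Projective A P] (ι : K →ₗ[A] P) (r : B ⊗[A] P →ₗ[B] B ⊗[A] K)
    (hr : r ∘ₗ ι.baseChange B = LinearMap.id) : ∃ s : P →ₗ[A] K, s ∘ₗ ι = LinearMap.id := by
  obtain ⟨s, hs⟩ := Module.projective_lifting_property (TensorProduct.mk A B K 1)
    (r.restrictScalars A ∘ₗ TensorProduct.mk A B P 1) (exists_one_tmul_eq hsurj)
  have hδ (k : K) : (LinearMap.id - s ∘ₗ ι : K →ₗ[A] K) k ∈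
      RingHom.ker (algebraMap A B) • (⊤ : Submodule A K) := by
    rw [← one_tmul_eq_zero_iff hsurj, LinearMap.sub_apply, TensorProduct.tmul_sub, sub_eq_zero]
    have h₁ := LinearMap.congr_fun hr (1 ⊗ₜ k)
    have h₂ := LinearMap.congr_fun hs (ι k)
    exact h₁.symm.trans h₂.symm
  have hann (a : A) (ha : a ∈ RingHom.ker (algebraMap A B)) (k : K)
      (hk : k ∈ RingHom.ker (algebraMap A B) • (⊤ : Submodule A K)) : a • k = 0 := by
    induction hk using Submodule.smul_induction_on' with
    | smul b hb m _ => rw [smul_smul, hsq ha hb, zero_smul]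
    | add x _ y _ hx hy => rw [smul_add, hx, hy, add_zero]
  have hδδ (k : K) (hk : k ∈ RingHom.ker (algebraMap A B) • (⊤ : Submodule A K)) :
      (LinearMap.id - s ∘ₗ ι : K →ₗ[A] K) k = 0 := by
    induction hk using Submodule.smul_induction_on' with
    | smul a ha n _ =>
      rw [map_smul]
      exact hann a ha _ (hδ n)
    | add x _ y _ hx hy => rw [map_add, hx, hy, add_zero]
  refine ⟨(LinearMap.id + (LinearMap.id - s ∘ₗ ι)) ∘ₗ s, LinearMap.ext fun k => ?_⟩
  have h := hδδ _ (hδ k)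
  simp only [LinearMap.sub_apply, LinearMap.id_apply, LinearMap.comp_apply, map_sub,
    LinearMap.add_apply] at h ⊢
  rw [sub_sub, sub_eq_zero] at h
  exact h.symm

theorem Ideal.IsSquareZeroDivisible.projective_of_baseChange
    (hsurj : Function.Surjective (algebraMap A B))
    (hI : (RingHom.ker (algebraMap A B)).IsSquareZeroDivisible) {n : ℕ} {M : Type u}
    [AddCommGroup M] [Module A M] (h : HasFPRLen A n M) (hM : Module.Projective B (B ⊗[A] M)) :
    Module.Projective A M := by
  induction n generalizing M with
  | zero => exact h.2
  | succ n ih =>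
    obtain ⟨P, _, _, f, _, hP, hf, hK⟩ := h
    have hinj := hI.baseChangePreservesFPR hsurj n P M f hP hf hK
    have hexact : Function.Exact ((LinearMap.ker f).subtype.baseChange B) (f.baseChange B) :=
      lTensor_exact B f.exact_subtype_ker_map hf
    obtain ⟨t, ht⟩ := Module.projective_lifting_property (f.baseChange B) LinearMap.id
      (LinearMap.lTensor_surjective B hf)
    obtain ⟨r, hr⟩ : ∃ r, r ∘ₗ (LinearMap.ker f).subtype.baseChange B = LinearMap.id :=
      ((hexact.split_tfae hinj (LinearMap.lTensor_surjective B hf)).out 0 1).mp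
        (Exists.intro t ht)
    obtain ⟨s, hs⟩ := exists_retraction_of_baseChange hsurj hI.mul_eq_zero _ r hr
    obtain ⟨g, hg⟩ : ∃ g, f ∘ₗ g = LinearMap.id :=
      ((f.exact_subtype_ker_map.split_tfae (LinearMap.ker f).injective_subtype hf).out 0 1).mpr
        (Exists.intro s hs)
    exact Module.Projective.of_split g f hg

theorem Ideal.IsSquareZeroDivisible.fPD_le (hsurj : Function.Surjective (algebraMap A B))
    (hI : (RingHom.ker (algebraMap A B)).IsSquareZeroDivisible) : fPD A ≤ fPD B :=
  (hI.baseChangePreservesFPR hsurj).fPD_le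
    fun _ _ _ _ h hM => hI.projective_of_baseChange hsurj h hM

end SurjectiveBaseChange

section TrivialExtension

instance Module.Flat.instProd {R M N : Type u} [CommRing R] [AddCommGroup M] [Module R M]
    [AddCommGroup N] [Module R N] [Module.Flat R M] [Module.Flat R N] :
    Module.Flat R (M × N) := by
  rw [Module.Flat.iff_rTensor_injectiveₛ]
  intro P _ _ S
  have h : ⇑(TensorProduct.prodRight R R P M N) ∘ S.subtype.rTensor (M × N) =
      Prod.map (S.subtype.rTensor M) (S.subtype.rTensor N) ∘
        TensorProduct.prodRight R R S M N := by
    ext x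
    · induction x with
      | zero => simp
      | tmul s m => simp
      | add x y hx hy => simp_all
    · induction x with
      | zero => simp
      | tmul s m => simp
      | add x y hx hy => simp_all
  refine Function.Injective.of_comp (f := TensorProduct.prodRight R R P M N) ?_
  rw [h]
  exact (Function.Injective.prodMap
    (Module.Flat.rTensor_preserves_injective_linearMap _ S.injective_subtype)
    (Module.Flat.rTensor_preserves_injective_linearMap _ S.injective_subtype)).comp
    (TensorProduct.prodRight R R S M N).injective

attribute [local instance] TrivSqZeroExt.algebraBase

theorem flat_trivSqZeroExt_fractionRing (D : Type u) [CommRing D] :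
    Module.Flat D (TrivSqZeroExt D (FractionRing D)) := by
  have : Module.Flat D (FractionRing D) := IsLocalization.flat _ (nonZeroDivisors D)
  exact inferInstanceAs (Module.Flat D (D × FractionRing D))

theorem isSquareZeroDivisible_ker_fst (D : Type u) [CommRing D] [IsDomain D] :
    (RingHom.ker (algebraMap (TrivSqZeroExt D (FractionRing D)) D)).IsSquareZeroDivisible := by
  have hmem {x : TrivSqZeroExt D (FractionRing D)} :
      x ∈ RingHom.ker (algebraMap (TrivSqZeroExt D (FractionRing D)) D) ↔ x.fst = 0 :=
    RingHom.mem_ker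
  refine ⟨RingHom.ker_isPrime _, ?_, ?_, ?_, ?_⟩
  · intro a b ha hb
    rw [hmem] at ha hb
    ext <;> simp [ha, hb]
  · intro r q hq hq0 hrq
    rw [hmem] at hq ⊢
    have h := congrArg TrivSqZeroExt.snd hrq
    have hq2 : q.snd ≠ 0 := fun h2 => hq0 (TrivSqZeroExt.ext hq h2)
    simpa [hq, hq2] using h
  · intro r q hr hq
    rw [hmem] at hr hq
    have hr' : algebraMap D (FractionRing D) r.fst ≠ 0 := by simpa using hr
    refine ⟨TrivSqZeroExt.inr ((algebraMap D (FractionRing D) r.fst)⁻¹ * q.snd), ?_, ?_⟩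
    · exact hmem.mpr (TrivSqZeroExt.fst_inr _ _)
    · ext
      · simp [hq]
      · simp [Algebra.smul_def, hr']
  · intro a b ha hb
    rw [hmem] at ha hb
    classical
    obtain ⟨d, hd⟩ := IsLocalization.exist_integer_multiples_of_finset (nonZeroDivisors D)
      {a.snd, b.snd}
    obtain ⟨x, hx⟩ := hd a.snd (by simp)
    obtain ⟨y, hy⟩ := hd b.snd (by simp)
    refine ⟨TrivSqZeroExt.inr (algebraMap D (FractionRing D) d)⁻¹,
      hmem.mpr (TrivSqZeroExt.fst_inr _ _),
      TrivSqZeroExt.inl x, TrivSqZeroExt.inl y, ?_, ?_⟩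
    · ext
      · simp [ha]
      · simp [Algebra.smul_def, hx, mul_comm]
    · ext
      · simp [hb]
      · simp [Algebra.smul_def, hy, mul_comm]

end TrivialExtension

/-- For a non-field domain `D` with quotient field `Q`, `fPD (D(+)Q) = fPD D`. -/
theorem fPD_trivSqZeroExt_fractionRing (D : Type u) [CommRing D] [IsDomain D]
    (hD : ¬ IsField D) :
    fPD (TrivSqZeroExt D (FractionRing D)) = fPD D := by
  let := TrivSqZeroExt.algebraBase D (FractionRing D)
  have := flat_trivSqZeroExt_fractionRing D
  exact le_antisymm ((isSquareZeroDivisible_ker_fst D).fPD_le TrivSqZeroExt.fst_surjective)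
    fPD_le_of_flat_of_retract
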